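/- arXiv:cs/0511023 — 2 statements merged into one kernel-verified Lean document; each statement's English description precedes it below -/
import Mathlib

section
/- For every NPLCS N and every set of locations A ⊆ Q, there exists a blind and memoryless scheduler U such that for all x ∈ Safe(A) and all channel contents w, Pr_U((x,w) ⊨ □A) = 1, i.e., almost surely the path stays forever in locations of A. -/
open scoped ENNReal
open Classical

namespace NPLCSmodel

/-! ## Lossy channel systems -/

/-- Operations of a lossy channel system: send a message on a channel,
receive a message from a channel, or an internal action. -/
inductive LcsOp (C M : Type) : Type where
  | send : C → M → LcsOp C M
  | recv : C → M → LcsOp C M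
  | internal : LcsOp C M

def LcsOp.IsRecv {C M : Type} : LcsOp C M → Prop
  | .recv _ _ => True
  | _ => False

/-- A transition rule `src --op--> dst`. -/
structure LcsRule (Q C M : Type) : Type where
  src : Q
  op : LcsOp C M
  dst : Q

/-- Channel contents: a word over `M` for each channel. -/
abbrev Chans (C M : Type) : Type := C → List M

/-- Configurations: a location together with channel contents. -/
abbrev Conf (Q C M : Type) : Type := Q × Chans C M

/-- The empty channel contents ε. -/
def eps (C M : Type) : Chans C M := fun _ => []

variable {Q C M : Type}

/-- When is an operation possible on channel contents `w`? -/
def enabledOp : LcsOp C M → Chans C M → Prop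
  | .recv c m, w => ∃ v, w c = m :: v
  | .send _ _, _ => True
  | .internal, _ => True

/-- Effect of an operation on the channel contents (for a perfect step). -/
def applyOp [DecidableEq C] : LcsOp C M → Chans C M → Chans C M
  | .send c m, w => Function.update w c (w c ++ [m])
  | .recv c _, w => Function.update w c (w c).tail
  | .internal, w => w

/-- A rule is enabled in a configuration. -/
def LcsRule.EnabledIn (δ : LcsRule Q C M) (s : Conf Q C M) : Prop :=
  δ.src = s.1 ∧ enabledOp δ.op s.2

/-- A lossy channel system `L = (Q, C, M, Δ)` (the finiteness of the location,
channel and message types is imposed by `Fintype` assumptions at use sites):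
a finite set of transition rules such that every location has at least one
outgoing rule that is not a receive. -/
structure LCS (Q C M : Type) : Type where
  rules : Set (LcsRule Q C M)
  finiteRules : rules.Finite
  noDeadlock : ∀ q : Q, ∃ δ ∈ rules, δ.src = q ∧ ¬ δ.op.IsRecv

variable [DecidableEq C]

/-- Lossy step via rule `δ`: a perfect step followed by losing arbitrarily
many messages (`<+` is the (componentwise) subword relation). -/
def LCS.StepVia (L : LCS Q C M) (s : Conf Q C M) (δ : LcsRule Q C M)
    (t : Conf Q C M) : Prop :=
  δ ∈ L.rules ∧ δ.EnabledIn s ∧ t.1 = δ.dst ∧ ∀ c, List.Sublist (t.2 c) (applyOp δ.op s.2 c)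

/-- Lossy step `s → t`. -/
def LCS.Step (L : LCS Q C M) (s t : Conf Q C M) : Prop := ∃ δ, L.StepVia s δ t

/-- Reachability `s →* t`. -/
def LCS.Reach (L : LCS Q C M) : Conf Q C M → Conf Q C M → Prop :=
  Relation.ReflTransGen L.Step

/-- Constrained reachability `s →*_[X) t`: all configurations along the path,
except possibly the last one, have their location in `X`. -/
def LCS.ReachWithin (L : LCS Q C M) (X : Set Q) : Conf Q C M → Conf Q C M → Prop :=
  Relation.ReflTransGen (fun a b => L.Step a b ∧ a.1 ∈ X)

/-- Constrained reachability `s →*_[X] t`: all configurations along the path,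
including `s` and `t`, have their location in `X`. -/
def LCS.ReachConstrained (L : LCS Q C M) (X : Set Q) (s t : Conf Q C M) : Prop :=
  L.ReachWithin X s t ∧ t.1 ∈ X

/-- `X` is safe for `A`. -/
def LCS.IsSafeFor (L : LCS Q C M) (A X : Set Q) : Prop :=
  X ⊆ A ∧ ∀ x ∈ X, ∃ t, L.Step (x, eps C M) t ∧ t.1 ∈ X

/-- `Safe(A)`: the largest set safe for `A` (the union of all such sets). -/
def LCS.Safe (L : LCS Q C M) (A : Set Q) : Set Q := ⋃₀ {X | L.IsSafeFor A X}

/-- `X` is promising for `A`. -/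
def LCS.IsPromisingFor (L : LCS Q C M) (A X : Set Q) : Prop :=
  ∀ x ∈ X, ∃ t, L.ReachWithin X (x, eps C M) t ∧ t.1 ∈ A

/-- `Prom(A)`: the largest set promising for `A` (the union of all such sets). -/
def LCS.Prom (L : LCS Q C M) (A : Set Q) : Set Q := ⋃₀ {X | L.IsPromisingFor A X}

/-! ## NPLCS and the induced Markov decision process -/

/-- An NPLCS: an LCS together with a fault rate `τ ∈ (0,1)`. -/
structure NPLCS (Q C M : Type) : Type where
  L : LCS Q C M
  τ : ℝ
  τ_pos : 0 < τ
  τ_lt_one : τ < 1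

/-- The number of embeddings of the second list as a subword of the first. -/
def countEmb [DecidableEq M] : List M → List M → ℕ
  | _, [] => 1
  | [], _ :: _ => 0
  | a :: v, b :: w => (if a = b then countEmb v w else 0) + countEmb v (b :: w)

variable [Fintype C] [DecidableEq M]

/-- Total number of messages in the channels. -/
def chansSize (w : Chans C M) : ℕ := ∑ c, (w c).length

/-- `P_lost(v,v') = τ^(|v|-|v'|) · (1-τ)^|v'| · C(v,v')`, the probability that
channel contents `v` become `v'` through message losses. -/
noncomputable def plost (τ : ℝ) (v v' : Chans C M) : ℝ≥0∞ :=
  ENNReal.ofReal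
    (τ ^ (chansSize v - chansSize v') * (1 - τ) ^ chansSize v' *
      (∏ c, countEmb (v c) (v' c) : ℕ))

/-- One-step probability `P_N(s, δ, t)` of the MDP of an NPLCS. -/
noncomputable def NPLCS.stepProb (N : NPLCS Q C M) (s : Conf Q C M)
    (δ : LcsRule Q C M) (t : Conf Q C M) : ℝ≥0∞ :=
  if δ ∈ N.L.rules ∧ δ.EnabledIn s ∧ t.1 = δ.dst then
    plost N.τ (applyOp δ.op s.2) t.2
  else 0

/-! ## Probability measure of a countable-state Markov chain

Given one-step probabilities `k` on a state space `S`, the measure of a set of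
trajectories is the Carathéodory outer measure generated by the probabilities
of cylinder sets; it agrees with the usual Markov-chain measure on all
measurable (in particular, on all ω-regular) sets of trajectories. -/

section Chain
variable {S : Type}

/-- Probability that the chain starting in `s` performs the finite sequence
of steps through the configurations listed in `l`. -/
noncomputable def chainPathProb (k : S → S → ℝ≥0∞) : S → List S → ℝ≥0∞
  | _, [] => 1
  | s, t :: l => k s t * chainPathProb k t l

/-- The cylinder of trajectories starting with `s` followed by `l`. -/
def chainCyl (s : S) (l : List S) : Set (ℕ → S) :=
  {ω | ω 0 = s ∧ ∀ (i : ℕ) (h : i < l.length), ω (i + 1) = l.get ⟨i, h⟩}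

/-- Premeasure: probability of a cylinder set, `∞` on other (nonempty) sets. -/
noncomputable def chainFun (k : S → S → ℝ≥0∞) (s : S) (A : Set (ℕ → S)) : ℝ≥0∞ :=
  if A = ∅ then 0 else ⨅ (l : List S) (_ : A = chainCyl s l), chainPathProb k s l

theorem chainFun_empty (k : S → S → ℝ≥0∞) (s : S) : chainFun k s ∅ = 0 := by
  simp [chainFun]

/-- The probability, for the Markov chain with one-step probabilities `k`
started in `s`, of the set `E` of trajectories (paths starting in `s`). -/
noncomputable def chainPr (k : S → S → ℝ≥0∞) (s : S) (E : Set (ℕ → S)) : ℝ≥0∞ :=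
  MeasureTheory.OuterMeasure.ofFunction (chainFun k s) (chainFun_empty k s)
    (E ∩ {ω | ω 0 = s})

end Chain

/-! ## Schedulers -/

/-- A (history-dependent, deterministic) scheduler: given the history
`h = s₁ → ⋯ → s_{n-1}` and the current configuration `sₙ`, it chooses a
transition rule of `N` enabled in `sₙ`. -/
structure Scheduler (N : NPLCS Q C M) : Type where
  choose : List (Conf Q C M) → Conf Q C M → LcsRule Q C M
  choose_mem : ∀ h s, choose h s ∈ N.L.rules
  choose_enabled : ∀ h s, (choose h s).EnabledIn s

variable {N : NPLCS Q C M}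

/-- The Markov chain `MC_U` induced by a scheduler: its states are finite
paths, represented as (history, current configuration). -/
noncomputable def Scheduler.kernel (U : Scheduler N) :
    List (Conf Q C M) × Conf Q C M → List (Conf Q C M) × Conf Q C M → ℝ≥0∞ :=
  fun a b =>
    if b.1 = a.1 ++ [a.2] then N.stepProb a.2 (U.choose a.1 a.2) b.2 else 0

/-- `Pr_U(s ⊨ E)`: the probability, under scheduler `U` with starting
configuration `s`, of the set `E` of infinite paths (trajectories of
configurations). -/
noncomputable def Scheduler.Pr (U : Scheduler N) (s : Conf Q C M)
    (E : Set (ℕ → Conf Q C M)) : ℝ≥0∞ :=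
  chainPr U.kernel ([], s) {ω | (fun i => (ω i).2) ∈ E}

/-- Memoryless scheduler: the decision depends only on the current
configuration. -/
def Scheduler.Memoryless (U : Scheduler N) : Prop :=
  ∀ h h' s, U.choose h s = U.choose h' s

/-- Blind scheduler: the decision depends only on the sequence of locations
that have been visited. -/
def Scheduler.Blind (U : Scheduler N) : Prop :=
  ∀ h h' s s', h.map Prod.fst = h'.map Prod.fst → s.1 = s'.1 →
    U.choose h s = U.choose h' s'

/-- Finite-memory scheduler data: finitely many modes, a starting mode, a
decision rule and a next-mode function. -/
structure FMScheduler (N : NPLCS Q C M) : Type 1 where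
  Mode : Type
  modeFin : Fintype Mode
  init : Mode
  D : Mode → Conf Q C M → LcsRule Q C M
  upd : Mode → Conf Q C M → Mode
  D_mem : ∀ u s, D u s ∈ N.L.rules
  D_enabled : ∀ u s, (D u s).EnabledIn s

/-- A scheduler is finite-memory if it is induced by finite-memory data. -/
def Scheduler.FiniteMemory (U : Scheduler N) : Prop :=
  ∃ fm : FMScheduler N, ∀ h s, U.choose h s = fm.D (h.foldl fm.upd fm.init) s

/-- The Markov chain `MC_U` of a finite-memory scheduler: states are pairs
`s_u` of a configuration `s` and a mode `u`. -/
noncomputable def FMScheduler.kernel (fm : FMScheduler N) :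
    Conf Q C M × fm.Mode → Conf Q C M × fm.Mode → ℝ≥0∞ :=
  fun a b =>
    if b.2 = fm.upd a.2 a.1 then N.stepProb a.1 (fm.D a.2 a.1) b.1 else 0

/-- Probability measure of the Markov chain `MC_U` of a finite-memory
scheduler, over trajectories of (configuration, mode) states. -/
noncomputable def FMScheduler.PrMC (fm : FMScheduler N)
    (a : Conf Q C M × fm.Mode) (E : Set (ℕ → Conf Q C M × fm.Mode)) : ℝ≥0∞ :=
  chainPr fm.kernel a E

/-- Reachability in the Markov chain `MC_U` of a finite-memory scheduler. -/
def FMScheduler.MCReach (fm : FMScheduler N) :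
    Conf Q C M × fm.Mode → Conf Q C M × fm.Mode → Prop :=
  Relation.ReflTransGen (fun a b => 0 < fm.kernel a b)

/-- The history (the first `i` configurations) of a trajectory. -/
def histTo (ω : ℕ → Conf Q C M) (i : ℕ) : List (Conf Q C M) :=
  (List.range i).map ω

/-- Almost blind scheduler: there are a scheduler `W` and a blind scheduler
`V` such that from any starting configuration, almost surely the choices of
`U` along the path agree with those of `W` up to some finite time and with
those of `V` afterwards. -/
def Scheduler.AlmostBlind (U : Scheduler N) : Prop :=
  ∃ W V : Scheduler N, V.Blind ∧ ∀ s : Conf Q C M,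
    U.Pr s {ω | ∃ n : ℕ,
      (∀ i ≤ n, U.choose (histTo ω i) (ω i) = W.choose (histTo ω i) (ω i)) ∧
      (∀ i, n < i → U.choose (histTo ω i) (ω i) = V.choose (histTo ω i) (ω i))} = 1

/-! ## LTL-style events on trajectories -/

/-- `□P` -/
def evAlways {α : Type} (P : α → Prop) : Set (ℕ → α) := {ω | ∀ i, P (ω i)}

/-- `◇P` -/
def evEventually {α : Type} (P : α → Prop) : Set (ℕ → α) := {ω | ∃ i, P (ω i)}

/-- `□◇P` -/
def evInfOften {α : Type} (P : α → Prop) : Set (ℕ → α) :=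
  {ω | ∀ n, ∃ i, n ≤ i ∧ P (ω i)}

/-- `◇□P` -/
def evEvAlways {α : Type} (P : α → Prop) : Set (ℕ → α) :=
  {ω | ∃ n, ∀ i, n ≤ i → P (ω i)}

/-- The atomic proposition "the current location belongs to `A`". -/
def inLoc (A : Set Q) : Conf Q C M → Prop := fun s => s.1 ∈ A


section ChainLowerBound
variable {S : Type}

/-- What remains of the sequence `l` to be followed after a step to `t`
(`none` if the step leaves `l`). -/
noncomputable def residual (t : S) : Option (List S) → Option (List S)
  | some (u :: l) => if u = t then some l else none
  | _ => none

/-- Probability of following a (residual) sequence from `s`. -/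
noncomputable def residualProb (k : S → S → ℝ≥0∞) (s : S) : Option (List S) → ℝ≥0∞
  | some l => chainPathProb k s l
  | none => 0

theorem tsum_mul_residualProb (k : S → S → ℝ≥0∞) (s : S) (o : Option (List S))
    (ho : o ≠ some []) :
    ∑' t, k s t * residualProb k t (residual t o) = residualProb k s o := by
  match o, ho with
  | none, _ => simp [residual, residualProb]
  | some [], ho => exact absurd rfl ho
  | some (u :: l), _ =>
    rw [tsum_eq_single u]
    · simp [residual, residualProb, chainPathProb]
    · intro t ht
      simp [residual, residualProb, ht.symm]

/-- If the residual sequences have total probability less than one, then some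
possible step preserves this. -/
theorem exists_step_residual_lt_one (k : S → S → ℝ≥0∞) (s : S)
    (hs : ∑' t, k s t = 1) (c : ℕ → Option (List S))
    (hc : ∑' n, residualProb k s (c n) < 1) :
    ∃ t, k s t ≠ 0 ∧ ∑' n, residualProb k t (residual t (c n)) < 1 := by
  by_contra! H
  have hne : ∀ n, c n ≠ some [] := by
    intro n hn
    have h1 := ENNReal.le_tsum (f := fun n => residualProb k s (c n)) n
    simp only [hn, residualProb, chainPathProb] at h1
    exact absurd hc (not_lt.mpr h1)
  have h2 : ∑' n, residualProb k s (c n)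
      = ∑' t, k s t * ∑' n, residualProb k t (residual t (c n)) := by
    simp_rw [← ENNReal.tsum_mul_left]
    rw [ENNReal.tsum_comm]
    exact tsum_congr fun n => (tsum_mul_residualProb k s (c n) (hne n)).symm
  have h3 : ∑' t, k s t ≤ ∑' t, k s t * ∑' n, residualProb k t (residual t (c n)) := by
    refine ENNReal.tsum_le_tsum fun t => ?_
    by_cases h0 : k s t = 0
    · simp [h0]
    · exact le_mul_of_one_le_right (zero_le) (H t h0)
  rw [hs, ← h2] at h3
  exact absurd hc (not_lt.mpr h3)

/-- The residual of `o` after the first `n` steps of `ω`. -/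
noncomputable def residualAlong (ω : ℕ → S) (o : Option (List S)) : ℕ → Option (List S)
  | 0 => o
  | n + 1 => residual (ω (n + 1)) (residualAlong ω o n)

theorem residualAlong_of_mem_chainCyl {s : S} {l : List S} {ω : ℕ → S}
    (hω : ω ∈ chainCyl s l) (n : ℕ) (hn : n ≤ l.length) :
    residualAlong ω (some l) n = some (l.drop n) := by
  induction n with
  | zero => simp [residualAlong]
  | succ n ih =>
    have h1 := hω.2 n (by omega)
    rw [residualAlong, ih (by omega), List.drop_eq_getElem_cons (by omega : n < l.length)]
    simp [residual, h1]

/-- A countable family of sequences of total probability less than one is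
avoided by some trajectory made of possible steps. -/
theorem exists_trajectory_avoiding (k : S → S → ℝ≥0∞) (s : S) (I : Set S)
    (hs : s ∈ I) (hk : ∀ a ∈ I, ∑' t, k a t = 1)
    (hI : ∀ a ∈ I, ∀ t, k a t ≠ 0 → t ∈ I) (c : ℕ → Option (List S))
    (hc : ∑' n, residualProb k s (c n) < 1) :
    ∃ ω : ℕ → S, ω 0 = s ∧ (∀ i, k (ω i) (ω (i + 1)) ≠ 0) ∧
      ∀ n l, c n = some l → ω ∉ chainCyl s l := by
  let P := {p : S × (ℕ → Option (List S)) //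
    p.1 ∈ I ∧ ∑' n, residualProb k p.1 (p.2 n) < 1}
  have hstep : ∀ p : P, ∃ q : P, k p.1.1 q.1.1 ≠ 0 ∧
      q.1.2 = fun n => residual q.1.1 (p.1.2 n) := by
    rintro ⟨⟨a, d⟩, ha, hd⟩
    obtain ⟨t, ht, hlt⟩ := exists_step_residual_lt_one k a (hk a ha) d hd
    exact ⟨⟨⟨t, fun n => residual t (d n)⟩, hI a ha t ht, hlt⟩, ht, rfl⟩
  choose f hf hf' using hstep
  let g : ℕ → P := fun n => f^[n] ⟨⟨s, c⟩, hs, hc⟩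
  have hg : ∀ n, g (n + 1) = f (g n) := fun n => Function.iterate_succ_apply' f n _
  have hres : ∀ i n, (g i).1.2 n = residualAlong (fun j => (g j).1.1) (c n) i := by
    intro i
    induction i with
    | zero => intro n; rfl
    | succ i ih =>
      intro n
      rw [residualAlong, ← ih n, hg, hf']
  refine ⟨fun j => (g j).1.1, rfl, fun i => ?_, fun n l hl hmem => ?_⟩
  · simp only [hg]
    exact hf _
  · have h1 := hres l.length n
    rw [hl, residualAlong_of_mem_chainCyl hmem l.length le_rfl, List.drop_length] at h1
    have h2 := ENNReal.le_tsum
      (f := fun m => residualProb k (g l.length).1.1 ((g l.length).1.2 m)) n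
    simp only [h1, residualProb, chainPathProb] at h2
    exact absurd (g l.length).2.2 (not_lt.mpr h2)

theorem chainFun_eq_residualProb [Nontrivial S] (k : S → S → ℝ≥0∞) (s : S)
    (B : Set (ℕ → S)) (hB : chainFun k s B ≠ ∞) :
    ∃ o : Option (List S), residualProb k s o ≤ chainFun k s B ∧
      ∀ ω ∈ B, ∃ l, o = some l ∧ ω ∈ chainCyl s l := by
  by_cases h0 : B = ∅
  · exact ⟨none, by simp [residualProb], by simp [h0]⟩
  · have hne : ∃ l, B = chainCyl s l := by
      by_contra! H
      apply hB
      simp [chainFun, h0, H]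
    obtain ⟨l, hl⟩ := hne
    refine ⟨some l, ?_, fun ω hω => ⟨l, rfl, hl ▸ hω⟩⟩
    have huniq : ∀ l', B = chainCyl s l' → l' = l := by
      intro l' hl'
      have hcyl : chainCyl s l = chainCyl s l' := hl.symm.trans hl'
      have key : ∀ l₁ l₂ : List S, chainCyl s l₁ = chainCyl s l₂ →
          ∀ i (h₂ : i < l₂.length), ∃ h₁ : i < l₁.length, l₁[i] = l₂[i] := by
        intro l₁ l₂ h i h₂
        obtain ⟨z, hz⟩ := exists_ne l₂[i]
        let ω : ℕ → S := fun j => if j = 0 then s else l₁.getD (j - 1) z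
        have hω : ω ∈ chainCyl s l₁ := by
          refine ⟨by simp [ω], fun j hj => ?_⟩
          simp [ω, hj]
        rw [h] at hω
        have h3 := hω.2 i h₂
        by_cases h₁ : i < l₁.length
        · refine ⟨h₁, ?_⟩
          simpa [ω, h₁] using h3
        · exact absurd (by simpa [ω, h₁] using h3) hz
      refine List.ext_getElem ?_ fun i h₁ h₂ => ?_
      · refine le_antisymm ?_ ?_
        · by_contra! hlt
          exact absurd (key l l' hcyl l.length hlt).1 (lt_irrefl _)
        · by_contra! hlt
          exact absurd (key l' l hcyl.symm l'.length hlt).1 (lt_irrefl _)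
      · exact (key l' l hcyl.symm i h₂).2
    simp only [chainFun, h0, if_false, residualProb]
    refine le_iInf₂ fun l' hl' => ?_
    rw [huniq l' hl']

/-- An event containing every trajectory made of possible steps inside a closed
stochastic set of states has probability one. -/
theorem chainPr_eq_one [Nontrivial S] (k : S → S → ℝ≥0∞) (s : S) (I : Set S)
    (hs : s ∈ I) (hk : ∀ a ∈ I, ∑' t, k a t = 1)
    (hI : ∀ a ∈ I, ∀ t, k a t ≠ 0 → t ∈ I) (E : Set (ℕ → S))
    (hE : ∀ ω : ℕ → S, ω 0 = s → (∀ i, ω i ∈ I) → ω ∈ E) :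
    chainPr k s E = 1 := by
  apply le_antisymm
  · have hsub : E ∩ {ω | ω 0 = s} ⊆ chainCyl s [] :=
      fun ω hω => ⟨hω.2, fun i h => absurd h (by simp)⟩
    refine (MeasureTheory.measure_mono hsub).trans
      ((MeasureTheory.OuterMeasure.ofFunction_le _).trans ?_)
    unfold chainFun
    split_ifs
    · exact zero_le
    · exact (iInf₂_le (f := fun l (_ : chainCyl s [] = chainCyl s l) =>
        chainPathProb k s l) [] rfl)
  · rw [chainPr, MeasureTheory.OuterMeasure.ofFunction_apply]
    refine le_iInf₂ fun t ht => ?_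
    by_contra! hlt
    have hfin : ∀ n, chainFun k s (t n) ≠ ∞ := fun n h =>
      absurd (h ▸ ENNReal.le_tsum (f := fun n => chainFun k s (t n)) n)
        (not_le.mpr (hlt.trans ENNReal.one_lt_top))
    choose c hc hc' using fun n => chainFun_eq_residualProb k s (t n) (hfin n)
    obtain ⟨ω, h0, hpos, hav⟩ := exists_trajectory_avoiding k s I hs hk hI c
      ((ENNReal.tsum_le_tsum hc).trans_lt hlt)
    have hin : ∀ i, ω i ∈ I := by
      intro i
      induction i with
      | zero => rwa [h0]
      | succ i ih => exact hI _ ih _ (hpos i)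
    obtain ⟨n, hn⟩ := Set.mem_iUnion.mp (ht ⟨hE ω h0 hin, h0⟩)
    obtain ⟨l, hl, hmem⟩ := hc' n ω hn
    exact hav n l hl hmem

end ChainLowerBound

section Losses

theorem countEmb_eq_count {M : Type} [DecidableEq M] (v w : List M) :
    countEmb v w = v.sublists'.count w := by
  induction v generalizing w with
  | nil => cases w <;> simp [countEmb]
  | cons a v ih =>
    rw [List.sublists'_cons, List.count_append]
    cases w with
    | nil =>
      have h := ih []
      rw [countEmb] at h
      rw [countEmb, ← h, List.count_eq_zero_of_not_mem (by simp)]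
    | cons b w =>
      rw [countEmb, ih, ih, add_comm]
      congr 1
      split_ifs with hab
      · subst hab
        exact (List.count_map_of_injective _ _ (List.cons_injective) _).symm
      · rw [List.count_eq_zero_of_not_mem]
        simp [hab]

theorem sum_map_sublists'_pow {M : Type} (x y : ℝ) (v : List M) :
    (v.sublists'.map fun w => x ^ (v.length - w.length) * y ^ w.length).sum
      = (x + y) ^ v.length := by
  induction v with
  | nil => simp
  | cons a v ih =>
    rw [List.sublists'_cons, List.map_append, List.sum_append, List.map_map,
      List.length_cons, pow_succ, mul_comm, add_mul]
    congr 1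
    · rw [← ih, ← List.sum_map_mul_left]
      congr 1
      refine List.map_congr_left fun w hw => ?_
      have := (List.mem_sublists'.mp hw).length_le
      rw [Nat.succ_sub this, pow_succ]
      ring
    · rw [← ih, ← List.sum_map_mul_left]
      congr 1
      refine List.map_congr_left fun w _ => ?_
      simp only [Function.comp, List.length_cons, Nat.add_sub_add_right, pow_succ]
      ring

theorem sum_loss_one {M : Type} [DecidableEq M] (τ : ℝ) (v : List M) :
    ∑ w ∈ v.sublists'.toFinset,
      τ ^ (v.length - w.length) * (1 - τ) ^ w.length * (countEmb v w : ℝ) = 1 := by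
  have h := Finset.sum_list_map_count v.sublists'
    (fun w => τ ^ (v.length - w.length) * (1 - τ) ^ w.length)
  rw [sum_map_sublists'_pow, add_sub_cancel, one_pow] at h
  refine Eq.trans (Finset.sum_congr rfl fun w _ => ?_) h.symm
  rw [countEmb_eq_count, nsmul_eq_mul, mul_comm]
  congr!

theorem tsum_plost {C M : Type} [DecidableEq C] [Fintype C] [DecidableEq M] (τ : ℝ)
    (h0 : 0 < τ) (h1 : τ < 1) (v : Chans C M) : ∑' w, plost τ v w = 1 := by
  have h1' : 0 ≤ 1 - τ := by linarith
  have hnn : ∀ c (w : List M), 0 ≤ τ ^ ((v c).length - w.length) * (1 - τ) ^ w.length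
      * (countEmb (v c) w : ℝ) := fun c w => by positivity
  rw [tsum_eq_sum (s := Fintype.piFinset fun c => (v c).sublists'.toFinset)]
  · have hw : ∀ w ∈ Fintype.piFinset fun c => (v c).sublists'.toFinset,
        plost τ v w = ENNReal.ofReal (∏ c, τ ^ ((v c).length - (w c).length)
          * (1 - τ) ^ (w c).length * (countEmb (v c) (w c) : ℝ)) := by
      intro w hw
      have hle : ∀ c, (w c).length ≤ (v c).length := fun c =>
        (List.mem_sublists'.mp (List.mem_toFinset.mp (Fintype.mem_piFinset.mp hw c))).length_le
      rw [plost, chansSize, chansSize, ← Finset.sum_tsub_distrib _ fun c _ => hle c,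
        Finset.prod_mul_distrib, Finset.prod_mul_distrib, Finset.prod_pow_eq_pow_sum,
        Finset.prod_pow_eq_pow_sum, Nat.cast_prod]
    rw [Finset.sum_congr rfl hw, ← ENNReal.ofReal_sum_of_nonneg
      fun w _ => Finset.prod_nonneg fun c _ => hnn c _]
    rw [← Finset.prod_univ_sum (fun c => (v c).sublists'.toFinset)
      (fun c w => τ ^ ((v c).length - w.length) * (1 - τ) ^ w.length
        * (countEmb (v c) w : ℝ))]
    simp [sum_loss_one]
  · intro w hw
    rw [Fintype.mem_piFinset] at hw
    push Not at hw
    obtain ⟨c, hc⟩ := hw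
    have hz : countEmb (v c) (w c) = 0 := by
      rw [countEmb_eq_count]
      exact List.count_eq_zero_of_not_mem fun h => hc (List.mem_toFinset.mpr h)
    rw [plost, Finset.prod_eq_zero (Finset.mem_univ c) hz]
    simp

end Losses

/-- The one-step probabilities of the chain induced by a scheduler sum to one. -/
theorem Scheduler.tsum_kernel {Q C M : Type} [DecidableEq C] [Fintype C] [DecidableEq M]
    {N : NPLCS Q C M} (U : Scheduler N) (a : List (Conf Q C M) × Conf Q C M) :
    ∑' b, U.kernel a b = 1 := by
  have hinj : Function.Injective
      (fun w : Chans C M => (a.1 ++ [a.2], ((U.choose a.1 a.2).dst, w))) := by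
    intro w w' h
    simpa using h
  rw [← tsum_plost N.τ N.τ_pos N.τ_lt_one (applyOp (U.choose a.1 a.2).op a.2.2),
    ← hinj.tsum_eq]
  · refine tsum_congr fun w => ?_
    simp [Scheduler.kernel, NPLCS.stepProb, U.choose_mem, U.choose_enabled]
  · rintro ⟨h, q, w⟩ hb
    simp only [Function.mem_support, Scheduler.kernel, NPLCS.stepProb, ne_eq, ite_eq_right_iff,
      Classical.not_imp] at hb
    obtain ⟨rfl, ⟨-, -, rfl⟩, -⟩ := hb
    exact ⟨w, rfl⟩

theorem LCS.exists_rule_of_mem_safe {Q C M : Type} [DecidableEq C] (L : LCS Q C M)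
    (A : Set Q) {x : Q} (hx : x ∈ L.Safe A) :
    ∃ δ ∈ L.rules, δ.src = x ∧ ¬ δ.op.IsRecv ∧ δ.dst ∈ L.Safe A := by
  obtain ⟨X, hX, hxX⟩ := hx
  obtain ⟨t, ⟨δ, hδ, ⟨hsrc, hen⟩, ht, -⟩, htX⟩ := hX.2 x hxX
  refine ⟨δ, hδ, hsrc, fun hr => ?_, X, hX, ht ▸ htX⟩
  cases hop : δ.op <;> simp [hop, LcsOp.IsRecv, enabledOp, eps] at hr hen

theorem LCS.safe_subset {Q C M : Type} [DecidableEq C] (L : LCS Q C M)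
    (A : Set Q) : L.Safe A ⊆ A :=
  Set.sUnion_subset fun _ hX => hX.1

theorem LcsRule.enabledIn_of_not_isRecv {Q C M : Type} {δ : LcsRule Q C M}
    (h : ¬ δ.op.IsRecv) (w : Chans C M) : δ.EnabledIn (δ.src, w) := by
  refine ⟨rfl, ?_⟩
  cases hop : δ.op <;> simp [hop, LcsOp.IsRecv, enabledOp] at h ⊢

/-- There is a blind and memoryless scheduler under which, from any
`x ∈ Safe(A)` with any channel contents, almost surely the path stays
forever in locations of `A`. -/
theorem statement1 {Q C M : Type} [Fintype Q] [Fintype C] [DecidableEq C]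
    [Fintype M] [DecidableEq M] (N : NPLCS Q C M) (A : Set Q) :
    ∃ U : Scheduler N, U.Blind ∧ U.Memoryless ∧
      ∀ x ∈ N.L.Safe A, ∀ w : Chans C M,
        U.Pr (x, w) (evAlways (inLoc A)) = 1 := by
  have hrule : ∀ q : Q, ∃ δ ∈ N.L.rules, δ.src = q ∧ ¬ δ.op.IsRecv ∧
      (q ∈ N.L.Safe A → δ.dst ∈ N.L.Safe A) := by
    intro q
    by_cases hq : q ∈ N.L.Safe A
    · obtain ⟨δ, h1, h2, h3, h4⟩ := N.L.exists_rule_of_mem_safe A hq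
      exact ⟨δ, h1, h2, h3, fun _ => h4⟩
    · obtain ⟨δ, h1, h2, h3⟩ := N.L.noDeadlock q
      exact ⟨δ, h1, h2, h3, fun h => absurd h hq⟩
  choose r hr hsrc hrecv hsafe using hrule
  let U : Scheduler N :=
    { choose := fun _ s => r s.1
      choose_mem := fun _ s => hr s.1
      choose_enabled := fun _ s => by
        have h := LcsRule.enabledIn_of_not_isRecv (hrecv s.1) s.2
        rwa [hsrc] at h }
  refine ⟨U, fun h h' s s' _ hs => congrArg r hs, fun _ _ _ => rfl, fun x hx w => ?_⟩
  have : Nontrivial (List (Conf Q C M) × Conf Q C M) :=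
    ⟨([], (x, w)), ([(x, w)], (x, w)), by simp⟩
  refine chainPr_eq_one U.kernel ([], (x, w)) {a | a.2.1 ∈ N.L.Safe A} hx
    (fun a _ => U.tsum_kernel a) ?_ _ fun ω _ hω i => N.L.safe_subset A (hω i)
  intro a ha t ht
  simp only [Scheduler.kernel, NPLCS.stepProb, ne_eq, ite_eq_right_iff,
    Classical.not_imp] at ht
  obtain ⟨-, ⟨-, -, hdst⟩, -⟩ := ht
  change t.2.1 ∈ N.L.Safe A
  exact hdst ▸ hsafe _ ha

end NPLCSmodel
end

section
/- For every NPLCS N, every set of locations A ⊆ Q and every location x ∈ Q: if Pr_U((x,ε) ⊨ ◇A) = 1 for some scheduler U, then x ∈ Prom(A). -/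
open scoped ENNReal
open Classical

namespace NPLCSmodel

variable {Q C M : Type}

variable [DecidableEq C]

variable [Fintype C] [DecidableEq M]

variable {N : NPLCS Q C M}

/-! ## Message losses -/

theorem sublist_of_countEmb_ne_zero (v w : List M) (h : countEmb v w ≠ 0) :
    List.Sublist w v := by
  induction v generalizing w with
  | nil => cases w with
    | nil => exact List.Sublist.slnil
    | cons b w => simp [countEmb] at h
  | cons a v ih => cases w with
    | nil => exact List.nil_sublist _
    | cons b w =>
      by_cases h2 : countEmb v (b :: w) = 0
      · by_cases hab : a = b
        · subst hab
          refine (ih w ?_).cons_cons a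
          simpa [countEmb, h2] using h
        · simp [countEmb, h2, hab] at h
      · exact (ih _ h2).cons a

/-- The probability that the single channel content `v` becomes `w` through losses. -/
noncomputable def wordLoss (τ : ℝ) (v w : List M) : ℝ≥0∞ :=
  ENNReal.ofReal (τ ^ (v.length - w.length) * (1 - τ) ^ w.length * (countEmb v w : ℕ))

theorem wordLoss_cons_le {τ : ℝ} (h0 : 0 < τ) (h1 : τ < 1) (a : M) (v w : List M) :
    wordLoss τ (a :: v) w ≤ ENNReal.ofReal τ * wordLoss τ v w +
      ∑' u, if w = a :: u then ENNReal.ofReal (1 - τ) * wordLoss τ v u else 0 := by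
  have h1' : 0 ≤ 1 - τ := by linarith
  have skip : ENNReal.ofReal (τ ^ (v.length + 1 - w.length) * (1 - τ) ^ w.length *
      (countEmb v w : ℕ)) = ENNReal.ofReal τ * wordLoss τ v w := by
    rw [wordLoss, ← ENNReal.ofReal_mul h0.le]
    by_cases hc : countEmb v w = 0
    · simp [hc]
    · have := (sublist_of_countEmb_ne_zero v w hc).length_le
      rw [Nat.sub_add_comm this, pow_succ]
      congr 1
      ring
  cases w with
  | nil =>
    refine le_trans (le_of_eq ?_) le_self_add
    rw [← skip]
    cases v <;> simp [wordLoss, countEmb]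
  | cons b w =>
    by_cases hab : a = b
    · subst hab
      refine le_trans (le_of_eq ?_) (add_le_add_right (ENNReal.le_tsum w) _)
      rw [← skip, if_pos rfl, wordLoss, wordLoss, ← ENNReal.ofReal_mul h1',
        ← ENNReal.ofReal_add (by positivity) (by positivity)]
      congr 1
      simp only [countEmb, List.length_cons, Nat.add_sub_add_right, if_true]
      push_cast
      ring
    · refine le_trans (le_of_eq ?_) le_self_add
      rw [← skip]
      simp [wordLoss, countEmb, hab]

theorem tsum_wordLoss_le {τ : ℝ} (h0 : 0 < τ) (h1 : τ < 1) (v : List M) :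
    ∑' w, wordLoss τ v w ≤ 1 := by
  induction v with
  | nil =>
    rw [tsum_eq_single []]
    · simp [wordLoss, countEmb]
    · intro w hw
      cases w with
      | nil => exact absurd rfl hw
      | cons b w => simp [wordLoss, countEmb]
  | cons a v ih =>
    calc ∑' w, wordLoss τ (a :: v) w
        ≤ ∑' w, (ENNReal.ofReal τ * wordLoss τ v w +
            ∑' u, if w = a :: u then ENNReal.ofReal (1 - τ) * wordLoss τ v u else 0) :=
          ENNReal.tsum_le_tsum fun w => wordLoss_cons_le h0 h1 a v w
      _ = ENNReal.ofReal τ * ∑' w, wordLoss τ v w +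
            ENNReal.ofReal (1 - τ) * ∑' w, wordLoss τ v w := by
          rw [ENNReal.tsum_add, ENNReal.tsum_mul_left, ENNReal.tsum_comm,
            ← ENNReal.tsum_mul_left (a := ENNReal.ofReal (1 - τ))]
          simp only [tsum_ite_eq]
      _ ≤ ENNReal.ofReal τ * 1 + ENNReal.ofReal (1 - τ) * 1 := by gcongr
      _ = 1 := by
          rw [mul_one, mul_one, ← ENNReal.ofReal_add h0.le (by linarith)]
          simp

theorem plost_le_prod {τ : ℝ} (h0 : 0 < τ) (h1 : τ < 1) (v w : Chans C M) :
    plost τ v w ≤ ∏ c, wordLoss τ (v c) (w c) := by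
  by_cases hz : ∃ c, countEmb (v c) (w c) = 0
  · obtain ⟨c, hc⟩ := hz
    have : ∏ c, countEmb (v c) (w c) = 0 := Finset.prod_eq_zero (Finset.mem_univ c) hc
    simp [plost, this]
  · push Not at hz
    have h1' : 0 ≤ 1 - τ := by linarith
    have hle : ∀ c ∈ Finset.univ, (w c).length ≤ (v c).length := fun c _ =>
      (sublist_of_countEmb_ne_zero _ _ (hz c)).length_le
    simp only [wordLoss]
    rw [← ENNReal.ofReal_prod_of_nonneg (fun c _ => by positivity), plost]
    refine le_of_eq (congrArg _ ?_)
    rw [Finset.prod_mul_distrib, Finset.prod_mul_distrib, Finset.prod_pow_eq_pow_sum,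
      Finset.prod_pow_eq_pow_sum, chansSize, chansSize, Finset.sum_tsub_distrib _ hle]
    push_cast
    rfl

theorem tsum_plost_le {τ : ℝ} (h0 : 0 < τ) (h1 : τ < 1) (v : Chans C M) :
    ∑' w, plost τ v w ≤ 1 := by
  refine ENNReal.summable.tsum_le_of_sum_le fun F => ?_
  let T : C → Finset (List M) := fun c => F.image fun w => w c
  calc ∑ w ∈ F, plost τ v w
      ≤ ∑ w ∈ F, ∏ c, wordLoss τ (v c) (w c) :=
        Finset.sum_le_sum fun w _ => plost_le_prod h0 h1 v w
    _ ≤ ∑ w ∈ Fintype.piFinset T, ∏ c, wordLoss τ (v c) (w c) := by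
        refine Finset.sum_le_sum_of_subset fun w hw => ?_
        exact Fintype.mem_piFinset.2 fun c => Finset.mem_image_of_mem _ hw
    _ = ∏ c, ∑ u ∈ T c, wordLoss τ (v c) u := (Finset.prod_univ_sum T _).symm
    _ ≤ 1 := Finset.prod_le_one' fun c _ =>
        (ENNReal.sum_le_tsum _).trans (tsum_wordLoss_le h0 h1 (v c))

theorem sublist_of_plost_ne_zero {τ : ℝ} {v w : Chans C M} (h : plost τ v w ≠ 0) (c : C) :
    List.Sublist (w c) (v c) := by
  refine sublist_of_countEmb_ne_zero _ _ fun hc => h ?_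
  have : ∏ c, countEmb (v c) (w c) = 0 := Finset.prod_eq_zero (Finset.mem_univ c) hc
  simp [plost, this]

theorem plost_eps_ne_zero {τ : ℝ} (h0 : 0 < τ) (v : Chans C M) : plost τ v (eps C M) ≠ 0 := by
  have h : ∀ l : List M, countEmb l [] = 1 := fun l => by cases l <;> rfl
  simp [plost, eps, chansSize, h, h0]

theorem step_of_stepProb_ne_zero (N : NPLCS Q C M) {s t : Conf Q C M} {δ : LcsRule Q C M}
    (h : N.stepProb s δ t ≠ 0) : N.L.Step s t := by
  unfold NPLCS.stepProb at h
  split_ifs at h with hc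
  · exact ⟨δ, hc.1, hc.2.1, hc.2.2, sublist_of_plost_ne_zero h⟩
  · exact absurd rfl h

theorem tsum_kernel_le (U : Scheduler N) (a : List (Conf Q C M) × Conf Q C M) :
    ∑' b, U.kernel a b ≤ 1 := by
  let δ := U.choose a.1 a.2
  let g : Chans C M → List (Conf Q C M) × Conf Q C M := fun w => (a.1 ++ [a.2], δ.dst, w)
  have hg : Function.Injective g := fun w w' h => by simpa [g] using h
  rw [← hg.tsum_eq]
  · refine le_trans (ENNReal.tsum_le_tsum fun w => ?_)
      (tsum_plost_le N.τ_pos N.τ_lt_one (applyOp δ.op a.2.2))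
    simp only [Scheduler.kernel, NPLCS.stepProb, g]
    split_ifs <;> simp [δ]
  · rintro ⟨h, q, w⟩ hb
    simp only [Function.mem_support, Scheduler.kernel, NPLCS.stepProb] at hb
    split_ifs at hb with h1 h2
    · exact ⟨w, by simp [g, δ, ← h1, ← h2.2.2]⟩
    · exact absurd rfl hb
    · exact absurd rfl hb

/-! ## Finite paths and cylinders -/

section Chain
variable {S : Type}

theorem chainPathProb_ofFn (k : S → S → ℝ≥0∞) (ω : ℕ → S) (n : ℕ) :
    chainPathProb k (ω 0) (List.ofFn fun i : Fin n => ω (i + 1)) =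
      ∏ i ∈ Finset.range n, k (ω i) (ω (i + 1)) := by
  induction n generalizing ω with
  | zero => simp [chainPathProb]
  | succ n ih =>
    rw [List.ofFn_succ, Finset.prod_range_succ', mul_comm]
    simpa [chainPathProb] using congrArg (k (ω 0) (ω 1) * ·) (ih fun i => ω (i + 1))

theorem tsum_chainPathProb_le (k : S → S → ℝ≥0∞) (hk : ∀ s, ∑' t, k s t ≤ 1) (n : ℕ) (s : S) :
    ∑' f : Fin n → S, chainPathProb k s (List.ofFn f) ≤ 1 := by
  induction n generalizing s with
  | zero => simp [chainPathProb]
  | succ n ih =>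
    rw [← (Fin.consEquiv fun _ => S).tsum_eq, ENNReal.tsum_prod']
    refine le_trans (ENNReal.tsum_le_tsum fun t => ?_) (hk s)
    have hcons : ∀ f : Fin n → S, chainPathProb k s (List.ofFn (Fin.consEquiv (fun _ => S) (t, f))) =
        k s t * chainPathProb k t (List.ofFn f) := fun f => by
      rw [show Fin.consEquiv (fun _ => S) (t, f) = Fin.cons t f from rfl, List.ofFn_cons]
      rfl
    rw [tsum_congr hcons, ENNReal.tsum_mul_left]
    exact mul_le_of_le_one_right' (ih t)

theorem mem_chainCyl_ofFn (ω : ℕ → S) (n : ℕ) :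
    ω ∈ chainCyl (ω 0) (List.ofFn fun i : Fin n => ω (i + 1)) := by
  simp [chainCyl]

theorem ofFunction_chainCyl_le (k : S → S → ℝ≥0∞) (s : S) (l : List S) :
    MeasureTheory.OuterMeasure.ofFunction (chainFun k s) (chainFun_empty k s) (chainCyl s l) ≤
      chainPathProb k s l := by
  refine (MeasureTheory.OuterMeasure.ofFunction_le _).trans ?_
  unfold chainFun
  split_ifs
  · exact zero_le
  · exact iInf₂_le (f := fun l' (_ : chainCyl s l = chainCyl s l') => chainPathProb k s l') l rfl

/-- If a path of positive probability has no positive-probability continuation in `E`, then `E`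
has probability less than one. -/
theorem chainPr_lt_one [Countable S] (k : S → S → ℝ≥0∞) (hk : ∀ s, ∑' t, k s t ≤ 1)
    (E : Set (ℕ → S)) (π : ℕ → S) (n : ℕ) (hpos : ∀ i < n, k (π i) (π (i + 1)) ≠ 0)
    (hE : ∀ ω ∈ E, (∀ i ≤ n, ω i = π i) → ∃ i, k (ω i) (ω (i + 1)) = 0) :
    chainPr k (π 0) E < 1 := by
  set μ := MeasureTheory.OuterMeasure.ofFunction (chainFun k (π 0)) (chainFun_empty k (π 0))
    with hμ
  let p : Fin n → S := fun i => π (i + 1)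
  let P : (Fin n → S) → ℝ≥0∞ := fun f => chainPathProb k (π 0) (List.ofFn f)
  have hP : ∑' f, P f ≤ 1 := tsum_chainPathProb_le k hk n (π 0)
  have hp : P p ≠ 0 := by
    simp only [P, p, chainPathProb_ofFn]
    exact Finset.prod_ne_zero_iff.2 fun i hi => hpos i (Finset.mem_range.1 hi)
  have hcover : E ∩ {ω | ω 0 = π 0} ⊆
      (⋃ l ∈ {l | chainPathProb k (π 0) l = 0}, chainCyl (π 0) l) ∪
        ⋃ f : {f : Fin n → S // f ≠ p}, chainCyl (π 0) (List.ofFn f.1) := by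
    rintro ω ⟨hω, h0 : ω 0 = π 0⟩
    by_cases hfp : (fun i : Fin n => ω (i + 1)) = p
    · left
      have hagree : ∀ i ≤ n, ω i = π i := by
        rintro (_ | i) hi
        · exact h0
        · exact congrFun hfp ⟨i, hi⟩
      obtain ⟨i, hi⟩ := hE ω hω hagree
      refine Set.mem_biUnion (x := List.ofFn fun j : Fin (i + 1) => ω (j + 1)) ?_ ?_
      · rw [Set.mem_ofPred_eq, ← h0, chainPathProb_ofFn]
        exact Finset.prod_eq_zero (Finset.self_mem_range_succ i) hi
      · rw [← h0]
        exact mem_chainCyl_ofFn ω (i + 1)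
    · right
      refine Set.mem_iUnion.2 ⟨⟨_, hfp⟩, ?_⟩
      rw [← h0]
      exact mem_chainCyl_ofFn ω n
  have hnull : μ (⋃ l ∈ {l | chainPathProb k (π 0) l = 0}, chainCyl (π 0) l) = 0 :=
    (MeasureTheory.measure_biUnion_null_iff (Set.to_countable _)).2 fun l hl =>
      le_antisymm ((ofFunction_chainCyl_le k (π 0) l).trans (le_of_eq hl)) zero_le
  have hbound : chainPr k (π 0) E ≤ ∑' f : {f : Fin n → S // f ≠ p}, P f.1 :=
    calc μ (E ∩ {ω | ω 0 = π 0})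
        ≤ _ := MeasureTheory.measure_mono hcover
      _ ≤ _ := MeasureTheory.measure_union_le _ _
      _ ≤ 0 + ∑' f : {f : Fin n → S // f ≠ p}, P f.1 := by
        refine add_le_add hnull.le ((MeasureTheory.measure_iUnion_le _).trans ?_)
        exact ENNReal.tsum_le_tsum fun f => ofFunction_chainCyl_le k (π 0) _
      _ = _ := zero_add _
  have hsplit : P p + ∑' f : {f : Fin n → S // f ≠ p}, P f.1 ≤ 1 := by
    refine le_trans (le_of_eq ?_) hP
    have := ENNReal.summable.tsum_add_tsum_compl (f := P) (s := {p}) ENNReal.summable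
    rw [← this, tsum_singleton]
    rfl
  refine hbound.trans_lt (lt_of_lt_of_le ?_ hsplit)
  have hfin : ∑' f : {f : Fin n → S // f ≠ p}, P f.1 ≠ ⊤ :=
    ne_top_of_le_ne_top ENNReal.one_ne_top (le_add_self.trans hsplit)
  rw [add_comm]
  exact ENNReal.lt_add_right hfin hp

theorem exists_path_of_reflTransGen {r : S → S → Prop} {a b : S} (h : Relation.ReflTransGen r a b) :
    ∃ (π : ℕ → S) (n : ℕ), π 0 = a ∧ π n = b ∧ ∀ i < n, r (π i) (π (i + 1)) := by
  induction h using Relation.ReflTransGen.head_induction_on with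
  | refl => exact ⟨fun _ => b, 0, rfl, rfl, by simp⟩
  | @head a c hac _ ih =>
    obtain ⟨π, n, h0, hn, hr⟩ := ih
    refine ⟨fun i => Nat.casesOn i a π, n + 1, rfl, hn, ?_⟩
    rintro (_ | i) hi
    · simpa [h0] using hac
    · exact hr i (by omega)

theorem reflTransGen_of_path {r : S → S → Prop} {ω : ℕ → S} {m n : ℕ} (hmn : m ≤ n)
    (h : ∀ i, m ≤ i → i < n → r (ω i) (ω (i + 1))) : Relation.ReflTransGen r (ω m) (ω n) := by
  induction n, hmn using Nat.le_induction with
  | base => exact .refl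
  | succ n hn ih => exact (ih fun i h1 h2 => h i h1 (by omega)).tail (h n hn (by omega))

/-- If `B` is reached almost surely, then it is reachable from every state that is reachable
outside `B` with positive probability. -/
theorem exists_reach_of_chainPr_eq_one [Countable S] (k : S → S → ℝ≥0∞)
    (hk : ∀ s, ∑' t, k s t ≤ 1) (B : Set S) (s b : S)
    (h : chainPr k s (evEventually (· ∈ B)) = 1)
    (hb : Relation.ReflTransGen (fun a b => k a b ≠ 0 ∧ a ∉ B) s b) :
    ∃ c ∈ B, Relation.ReflTransGen (fun a b => k a b ≠ 0 ∧ a ∉ B) b c := by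
  by_contra! hcon
  obtain ⟨π, n, rfl, rfl, hπ⟩ := exists_path_of_reflTransGen hb
  refine (chainPr_lt_one k hk (evEventually (· ∈ B)) π n (fun i hi => (hπ i hi).1) ?_).ne h
  intro ω hω hagree
  by_contra! hne
  have havoid : ∀ i < n, ω i ∉ B := fun i hi => hagree i hi.le ▸ (hπ i hi).2
  have hspec := Nat.find_spec hω
  have hmin : ∀ i < Nat.find hω, ω i ∉ B := fun i => Nat.find_min hω
  have hle : n ≤ Nat.find hω := by
    by_contra! hlt
    exact havoid _ hlt hspec
  refine hcon _ hspec ?_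
  rw [← hagree n le_rfl]
  exact reflTransGen_of_path hle fun i _ hi => ⟨hne i, hmin i hi⟩

end Chain

/-- If some scheduler satisfies `◇A` almost surely from `(x,ε)`, then
`x ∈ Prom(A)`. -/
theorem statement5 {Q C M : Type} [Fintype Q] [Fintype C] [DecidableEq C]
    [Fintype M] [DecidableEq M] (N : NPLCS Q C M) (A : Set Q) (x : Q)
    (h : ∃ U : Scheduler N, U.Pr (x, eps C M) (evEventually (inLoc A)) = 1) :
    x ∈ N.L.Prom A := by
  obtain ⟨U, hU⟩ := h
  let B : Set (List (Conf Q C M) × Conf Q C M) := {a | a.2.1 ∈ A}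
  let s : List (Conf Q C M) × Conf Q C M := ([], x, eps C M)
  let R := Relation.ReflTransGen fun a b => U.kernel a b ≠ 0 ∧ a ∉ B
  let X : Set Q := {y | ∃ b, R s b ∧ b.2.1 = y}
  refine Set.mem_sUnion.2 ⟨X, ?_, s, .refl, rfl⟩
  rintro y ⟨⟨h, y', w⟩, hb, rfl⟩
  have hempty : ∃ h', R s (h', y', eps C M) := by
    rcases Relation.ReflTransGen.cases_tail hb with heq | ⟨a, ha, hab, haB⟩
    · obtain ⟨-, rfl, rfl⟩ : h = [] ∧ y' = x ∧ w = eps C M := by simpa [s] using heq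
      exact ⟨[], .refl⟩
    · refine ⟨h, ha.tail ⟨?_, haB⟩⟩
      simp only [Scheduler.kernel, NPLCS.stepProb] at hab ⊢
      split_ifs at hab ⊢
      · exact plost_eps_ne_zero N.τ_pos _
      all_goals exact absurd rfl hab
  obtain ⟨h', hs⟩ := hempty
  obtain ⟨c, hc, hreach⟩ := exists_reach_of_chainPr_eq_one U.kernel (tsum_kernel_le U) B s _ hU hs
  refine ⟨c.2, ?_, hc⟩
  clear hc
  induction hreach with
  | refl => exact .refl
  | @tail d e hd hde ih =>
    refine ih.tail ⟨?_, d, hs.trans hd, rfl⟩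
    have hk := hde.1
    unfold Scheduler.kernel at hk
    split_ifs at hk with hhist
    · exact step_of_stepProb_ne_zero N hk
    · exact absurd rfl hk

end NPLCSmodel
end
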